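/- Let q = 2^t for a positive integer t. The F_2-span of Z ∪ X0 equals the F_2-span of {χ_m : m ∈ L1} ∪ X0 inside F_2[P]. -/

import Mathlib

open Submodule Module
open scoped Classical

noncomputable section

variable (k : Type) [Field k] [Fintype k]

/-- The nonsingular alternating bilinear form on `k^4`. -/
def B (u v : Fin 4 → k) : k := u 0 * v 3 - u 3 * v 0 + u 1 * v 2 - u 2 * v 1

/-- Points of the projective space: 1-dimensional subspaces of `k^4`. -/
def IsPt (p : Submodule k (Fin 4 → k)) : Prop := finrank k p = 1

/-- Lines: totally isotropic 2-dimensional subspaces of `k^4`. -/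
def IsLn (l : Submodule k (Fin 4 → k)) : Prop :=
  finrank k l = 2 ∧ ∀ u ∈ l, ∀ v ∈ l, B k u v = 0

/-- The point set `P`. -/
abbrev Pt := {p : Submodule k (Fin 4 → k) // IsPt k p}

def e (i : Fin 4) : Fin 4 → k := Pi.single i 1

/-- The fixed point `p0 = span{e0}`. -/
def p0 : Submodule k (Fin 4 → k) := span k {e k 0}

/-- The fixed line `ℓ0 = span{e0, e1}`. -/
def l0 : Submodule k (Fin 4 → k) := span k {e k 0, e k 1}

/-- Membership in `P1`: points `span{v}` with `B(e0, v) ≠ 0`. -/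
def InP1 (p : Pt k) : Prop := ∃ v ∈ (p : Submodule k (Fin 4 → k)), B k (e k 0) v ≠ 0

/-- The characteristic function of a line, as an `F_2`-valued function on `P`. -/
def chi (l : Submodule k (Fin 4 → k)) : Pt k → ZMod 2 :=
  fun p => if (p : Submodule k (Fin 4 → k)) ≤ l then 1 else 0

/-- The set `L1` of lines meeting `ℓ0` only in `0`. -/
def L1 : Set (Submodule k (Fin 4 → k)) := {l | IsLn k l ∧ l ⊓ l0 k = ⊥}

/-- The code `C(P,L)`. -/
def CPL : Submodule (ZMod 2) (Pt k → ZMod 2) := span (ZMod 2) (chi k '' {l | IsLn k l})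

/-- The code `C(P,L1)`. -/
def CPL1 : Submodule (ZMod 2) (Pt k → ZMod 2) := span (ZMod 2) (chi k '' L1 k)

/-- Restriction of functions on `P` to `P1`. -/
def piP1 : (Pt k → ZMod 2) →ₗ[ZMod 2] ({p : Pt k // InP1 k p} → ZMod 2) :=
  LinearMap.funLeft (ZMod 2) (ZMod 2) Subtype.val

/-- The code `C(P1,L1)`, the image of `C(P,L1)` under restriction to `P1`. -/
def CP1L1 : Submodule (ZMod 2) ({p : Pt k // InP1 k p} → ZMod 2) := (CPL1 k).map (piP1 k)

/-- `X0`: the characteristic functions of the lines through `p0`, except `χ_{ℓ0}`. -/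
def X0 : Set (Pt k → ZMod 2) :=
  (chi k '' {l | IsLn k l ∧ p0 k ≤ l}) \ {chi k (l0 k)}

set_option linter.unusedSectionVars false

/-- Over a finite field with `q` elements, the values of a polynomial of degree at most `q - 1`
sum to minus its coefficient of degree `q - 1`. -/
lemma sum_eval_eq_neg_coeff {K : Type} [Field K] [Fintype K] (p : Polynomial K)
    (hp : p.natDegree ≤ Fintype.card K - 1) :
    ∑ x, p.eval x = -p.coeff (Fintype.card K - 1) := by
  have hq : 1 < Fintype.card K := Fintype.one_lt_card
  have htop : ∑ x : K, x ^ (Fintype.card K - 1) = -1 := by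
    have h (x : K) : x ^ (Fintype.card K - 1) = 1 - if x = 0 then 1 else 0 := by
      split_ifs with hx
      · rw [hx, zero_pow (by omega), sub_self]
      · rw [FiniteField.pow_card_sub_one_eq_one x hx, sub_zero]
    simp [h]
  simp_rw [Polynomial.eval_eq_sum_range' (Nat.lt_succ_of_le hp)]
  rw [Finset.sum_comm]
  simp_rw [← Finset.mul_sum]
  rw [Finset.sum_range_succ, htop, Finset.sum_eq_zero, zero_add, mul_neg_one]
  intro i hi
  rw [FiniteField.sum_pow_lt_card_sub_one K i (Finset.mem_range.mp hi), mul_zero]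

/-- A function on a finite field whose first `n` power moments vanish is given by a polynomial
of degree less than `q - n`. -/
lemma exists_polynomial_of_moments_eq_zero {K : Type} [Field K] [Fintype K] (φ : K → K) (n : ℕ)
    (h : ∀ j < n, ∑ x, x ^ j * φ x = 0) :
    ∃ P : Polynomial K, (P = 0 ∨ P.natDegree + n < Fintype.card K) ∧ ∀ x, P.eval x = φ x := by
  have hinj : Set.InjOn (id : K → K) (Finset.univ : Finset K) := Function.injective_id.injOn
  have heval (x : K) : (Lagrange.interpolate Finset.univ id φ).eval x = φ x :=
    Lagrange.eval_interpolate_at_node φ hinj (Finset.mem_univ x)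
  have hdeg := Lagrange.degree_interpolate_lt φ hinj
  set P := Lagrange.interpolate Finset.univ id φ
  refine ⟨P, or_iff_not_imp_left.mpr fun hP => ?_, heval⟩
  have hd : P.natDegree < Fintype.card K := (Polynomial.natDegree_lt_iff_degree_lt hP).mpr hdeg
  by_contra! hn
  have hdegj : (Polynomial.X ^ (Fintype.card K - 1 - P.natDegree) * P).natDegree
      ≤ Fintype.card K - 1 := by
    rw [Polynomial.natDegree_X_pow_mul _ hP]
    omega
  have hsum := sum_eval_eq_neg_coeff _ hdegj
  simp only [Polynomial.eval_mul, Polynomial.eval_pow, Polynomial.eval_X, heval] at hsum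
  rw [h _ (by omega), Polynomial.coeff_X_pow_mul', if_pos (by omega),
    show Fintype.card K - 1 - (Fintype.card K - 1 - P.natDegree) = P.natDegree by omega] at hsum
  exact hP (Polynomial.leadingCoeff_eq_zero.mp (neg_eq_zero.mp hsum.symm))

/-- An idempotent-valued function on a finite field, at least half of whose power moments vanish,
is constant. -/
lemma const_of_moments_eq_zero {K : Type} [Field K] [Fintype K] (φ : K → K)
    (hφ : ∀ x, φ x ^ 2 = φ x) (n : ℕ) (hn : Fintype.card K ≤ 2 * n)
    (h : ∀ j < n, ∑ x, x ^ j * φ x = 0) (x y : K) : φ x = φ y := by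
  obtain ⟨P, hP, heval⟩ := exists_polynomial_of_moments_eq_zero φ n h
  have hq : 1 < Fintype.card K := Fintype.one_lt_card
  have hidem : P ^ 2 - P = 0 := by
    rcases hP with rfl | hP
    · simp
    have hdeg : (P ^ 2 - P).natDegree < Fintype.card K := by
      refine (Polynomial.natDegree_sub_le _ _).trans_lt (max_lt ?_ (by omega))
      exact Polynomial.natDegree_pow_le.trans_lt (by omega)
    refine Polynomial.eq_zero_of_natDegree_lt_card_of_eval_eq_zero _
      (Function.injective_id (α := K)) (fun z => ?_) hdeg
    simp [heval, hφ]
  have hfac : P * (P - 1) = 0 := by linear_combination hidem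
  rw [← heval, ← heval]
  rcases mul_eq_zero.mp hfac with h0 | h1
  · simp [h0]
  · simp [sub_eq_zero.mp h1]

/-- For `K` of order `2 ^ (m + 1)`, the monomial `s ^ (2 ^ m * ε + i) * x ^ j` is obtained by
summing a function on the affine points over the lines of `L1`. -/
lemma sum_leading_product {K : Type} [Field K] [Fintype K] [CharP K 2] {m : ℕ}
    (hm : Fintype.card K = 2 ^ (m + 1)) {ε i j : ℕ} (hε : ε ≤ 1) (hi : i < 2 ^ m) (hj : j < 2 ^ m)
    (x s y : K) :
    ∑ c, ((y + c * x) + (x + c * s) * c) ^ (2 ^ m * ε) * (x + c * s) ^ i * (y + c * x) ^ j *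
      c ^ (Fintype.card K - 1 - (ε + i + j)) = s ^ (2 ^ m * ε + i) * x ^ j := by
  have hq : ε + i + j ≤ Fintype.card K - 1 := by rw [hm, pow_succ]; omega
  have hlin (u v : K) : (Polynomial.C u + Polynomial.C v * Polynomial.X).natDegree ≤ 1 := by
    compute_degree
  have hcoeff (u v : K) : (Polynomial.C u + Polynomial.C v * Polynomial.X).coeff 1 = v := by
    simp [Polynomial.coeff_C]
  have hlinp (u v : K) (n : ℕ) :
      ((Polynomial.C u + Polynomial.C v * Polynomial.X) ^ n).natDegree ≤ n := by
    simpa using Polynomial.natDegree_pow_le_of_le n (hlin u v)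
  have hcoeffp (u v : K) (n : ℕ) :
      ((Polynomial.C u + Polynomial.C v * Polynomial.X) ^ n).coeff n = v ^ n := by
    simpa [hcoeff] using Polynomial.coeff_pow_of_natDegree_le (m := n) (hlin u v)
  have h1 := Polynomial.natDegree_mul_le_of_le (hlinp (y ^ 2 ^ m) (s ^ 2 ^ m) ε) (hlinp x s i)
  have h2 := Polynomial.natDegree_mul_le_of_le h1 (hlinp y x j)
  have h3 := Polynomial.natDegree_mul_le_of_le h2
    (Polynomial.natDegree_X_pow_le (R := K) (Fintype.card K - 1 - (ε + i + j)))
  have hsum := sum_eval_eq_neg_coeff _ (h3.trans (by omega))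
  have hc := Polynomial.coeff_mul_add_eq_of_natDegree_le h2
    (Polynomial.natDegree_X_pow_le (R := K) (Fintype.card K - 1 - (ε + i + j)))
  rw [Nat.add_sub_cancel' hq, Polynomial.coeff_mul_add_eq_of_natDegree_le h1 (hlinp y x j),
    Polynomial.coeff_mul_add_eq_of_natDegree_le (hlinp _ _ ε) (hlinp x s i), hcoeffp, hcoeffp, hcoeffp,
    Polynomial.coeff_X_pow_self] at hc
  rw [hc, CharTwo.neg_eq] at hsum
  rw [pow_add, pow_mul, ← mul_one (_ * _ * _), ← hsum]
  refine Finset.sum_congr rfl fun c _ => ?_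
  have hfrob : (y + c * x + (x + c * s) * c) ^ 2 ^ m = y ^ 2 ^ m + s ^ 2 ^ m * c := by
    have h0 : y + c * x + (x + c * s) * c = y + s * c ^ 2 := by
      linear_combination c * x * CharTwo.two_eq_zero (R := K)
    rw [h0, add_pow_char_pow, mul_pow, ← pow_mul, ← pow_succ', ← hm, FiniteField.pow_card]
  simp only [Polynomial.eval_mul, Polynomial.eval_pow, Polynomial.eval_add, Polynomial.eval_C,
    Polynomial.eval_X, pow_mul, hfrob, mul_comm s c, mul_comm x c]

/-- Let `F` be idempotent-valued and orthogonal to every `G` arising by summing a function on the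
affine points over the lines of `L1`. Then `F` is constant in its first variable, with the
constants summing to zero. -/
lemma const_of_orthogonal {K : Type} [Field K] [Fintype K] [CharP K 2] {m : ℕ}
    (hm : Fintype.card K = 2 ^ (m + 1)) (F : K → K → K) (hF : ∀ x s, F x s ^ 2 = F x s)
    (horth : ∀ (H : K → K → K → K) (G : K → K → K),
      (∀ x s y, ∑ c, H (y + c * x) (x + c * s) c = G x s) → ∑ s, ∑ x, G x s * F x s = 0) :
    (∀ x y s, F x s = F y s) ∧ ∑ s, F 0 s = 0 := by
  have hpos : 0 < 2 ^ m := by positivity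
  constructor
  · intro x y s
    refine const_of_moments_eq_zero (F · s) (hF · s) (2 ^ m) (by rw [hm, pow_succ']) ?_ x y
    intro j hj
    obtain ⟨P, hP, heval⟩ := exists_polynomial_of_moments_eq_zero
      (fun s => ∑ x, x ^ j * F x s) (Fintype.card K) fun i hi => by
        have hdiv : i / 2 ^ m ≤ 1 :=
          Nat.le_of_lt_succ ((Nat.div_lt_iff_lt_mul hpos).mpr (by rw [← pow_succ', ← hm]; exact hi))
        have := horth
          (fun a b c => (a + b * c) ^ (2 ^ m * (i / 2 ^ m)) * b ^ (i % 2 ^ m) * a ^ j *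
            c ^ (Fintype.card K - 1 - (i / 2 ^ m + i % 2 ^ m + j)))
          (fun x s => s ^ (2 ^ m * (i / 2 ^ m) + i % 2 ^ m) * x ^ j) fun x s y =>
          sum_leading_product hm hdiv (Nat.mod_lt i hpos) hj x s y
        simpa only [Nat.div_add_mod, mul_assoc, Finset.mul_sum] using this
    have hP0 : P = 0 := hP.resolve_right (by omega)
    simpa [hP0] using (heval s).symm
  · have := horth (fun _ b c => if c = 0 then if b = 0 then 1 else 0 else 0)
      (fun x _ => if x = 0 then 1 else 0) fun x s y => by simp
    simpa using this

/-- The point spanned by a nonzero vector. -/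
def ptOf (v : Fin 4 → k) (hv : v ≠ 0) : Pt k := ⟨span k {v}, finrank_span_singleton hv⟩

/-- The points of `P1`, in affine coordinates. -/
def affinePt (a b c : k) : Pt k := ptOf k ![a, b, c, 1] fun h => by simpa using congrFun h 3

/-- The points of `p0^⊥` not on `ℓ0`. -/
def inftyPt (x s : k) : Pt k := ptOf k ![x, s, 1, 0] fun h => by simpa using congrFun h 2

lemma chi_ptOf (l : Submodule k (Fin 4 → k)) (v : Fin 4 → k) (hv : v ≠ 0) :
    chi k l (ptOf k v hv) = if v ∈ l then 1 else 0 := by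
  simp [chi, ptOf, span_singleton_le_iff_mem]

lemma exists_eq_ptOf (p : Pt k) : ∃ v hv, p = ptOf k v hv := by
  obtain ⟨⟨v, hv⟩, h0, h⟩ := finrank_eq_one_iff'.mp p.2
  refine ⟨v, fun h => h0 (Subtype.ext h), Subtype.ext (le_antisymm (fun w hw => ?_) ?_)⟩
  · obtain ⟨c, hc⟩ := h ⟨w, hw⟩
    exact mem_span_singleton.mpr ⟨c, congrArg Subtype.val hc⟩
  · exact (span_singleton_le_iff_mem v _).mpr hv

lemma ptOf_eq_of_smul {v w : Fin 4 → k} (hv : v ≠ 0) (hw : w ≠ 0) {c : k} (h : v = c • w) :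
    ptOf k v hv = ptOf k w hw := by
  have hc : c ≠ 0 := by rintro rfl; exact hv (by simp [h])
  subst h
  exact Subtype.ext (span_singleton_smul_eq hc.isUnit w)

lemma inP1_ptOf {v : Fin 4 → k} (hv : v ≠ 0) (h3 : v 3 ≠ 0) : InP1 k (ptOf k v hv) :=
  ⟨v, mem_span_singleton_self v, by simpa [B, e] using h3⟩

lemma mem_l0 (v : Fin 4 → k) : v ∈ l0 k ↔ v 2 = 0 ∧ v 3 = 0 := by
  rw [l0, mem_span_pair]
  constructor
  · rintro ⟨a, b, rfl⟩
    simp [e]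
  · rintro ⟨h2, h3⟩
    refine ⟨v 0, v 1, ?_⟩
    ext i
    fin_cases i <;> simp [e, h2, h3]

/-- Coordinate equations for the lines of `L1`. -/
lemma exists_equations_of_mem_L1 {l : Submodule k (Fin 4 → k)} (hl : l ∈ L1 k) :
    ∃ x s y : k, ∀ v, v ∈ l ↔ v 0 = v 3 * y + v 2 * x ∧ v 1 = v 3 * x + v 2 * s := by
  obtain ⟨⟨hrank, hiso⟩, hdisj⟩ := hl
  have hzero {v : Fin 4 → k} (hv : v ∈ l) (h2 : v 2 = 0) (h3 : v 3 = 0) : v = 0 := by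
    rw [← mem_bot k, ← hdisj]
    exact ⟨hv, (mem_l0 k v).mpr ⟨h2, h3⟩⟩
  let g : l →ₗ[k] k × k :=
    ((LinearMap.proj 2).prod (LinearMap.proj 3)).comp l.subtype
  have hinj : Function.Injective g := by
    rw [← LinearMap.ker_eq_bot, eq_bot_iff]
    rintro ⟨v, hv⟩ h
    obtain ⟨h2, h3⟩ := Prod.mk.inj (LinearMap.mem_ker.mp h)
    exact (mem_bot k).mpr (Subtype.ext (hzero hv h2 h3))
  have hsurj : Function.Surjective g :=
    (LinearMap.injective_iff_surjective_of_finrank_eq_finrank (by simp [hrank])).mp hinj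
  obtain ⟨⟨u, hu⟩, hgu⟩ := hsurj (1, 0)
  obtain ⟨⟨w, hw⟩, hgw⟩ := hsurj (0, 1)
  obtain ⟨hu2, hu3⟩ : u 2 = 1 ∧ u 3 = 0 := Prod.mk.inj hgu
  obtain ⟨hw2, hw3⟩ : w 2 = 0 ∧ w 3 = 1 := Prod.mk.inj hgw
  have hB : w 1 = u 0 := by
    have := hiso u hu w hw
    simp only [B, hu2, hu3, hw2, hw3] at this
    linear_combination -this
  refine ⟨u 0, u 1, w 0, fun v => ⟨fun hv => ?_, fun ⟨h0, h1⟩ => ?_⟩⟩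
  · have hv0 := hzero (l.sub_mem hv (l.add_mem (l.smul_mem (v 3) hw) (l.smul_mem (v 2) hu)))
      (by simp [hu2, hw2]) (by simp [hu3, hw3])
    have h0 := congrFun hv0 0
    have h1 := congrFun hv0 1
    simp only [Pi.sub_apply, Pi.add_apply, Pi.smul_apply, Pi.zero_apply, smul_eq_mul, hB] at h0 h1
    exact ⟨sub_eq_zero.mp h0, sub_eq_zero.mp h1⟩
  · have hv : v = v 3 • w + v 2 • u := by
      ext i
      fin_cases i <;> simp [h0, h1, hB, hu2, hu3, hw2, hw3]
    rw [hv]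
    exact l.add_mem (l.smul_mem _ hw) (l.smul_mem _ hu)

/-- Functions orthogonal to the code `C(P,L1)`. -/
lemma sum_affinePt_eq_sum_inftyPt [CharP k 2] {f : Pt k → ZMod 2} (hf : f ∈ CPL1 k)
    {H : k → k → k → k} {G : k → k → k}
    (hHG : ∀ x s y, ∑ c, H (y + c * x) (x + c * s) c = G x s) :
    ∑ c, ∑ a, ∑ b, H a b c * ZMod.castHom (dvd_refl 2) k (f (affinePt k a b c)) =
      ∑ s, ∑ x, G x s * ZMod.castHom (dvd_refl 2) k (f (inftyPt k x s)) := by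
  induction hf using span_induction with
  | mem g hg =>
    obtain ⟨l, hl, rfl⟩ := hg
    obtain ⟨x, s, y, h⟩ := exists_equations_of_mem_L1 k hl
    simp [affinePt, inftyPt, chi_ptOf, h, apply_ite (ZMod.cast : ZMod 2 → k), ite_and, hHG]
  | zero => simp
  | add f g _ _ hf hg => simp only [Pi.add_apply, map_add, mul_add, Finset.sum_add_distrib, hf, hg]
  | smul r f _ hf =>
    simp only [Pi.smul_apply, smul_eq_mul, map_mul, mul_left_comm _ (ZMod.castHom _ k r),
      ← Finset.mul_sum, hf]

lemma apply_eq_zero_of_le_l0 {f : Pt k → ZMod 2} (hf : f ∈ CPL1 k) {p : Pt k}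
    (hp : (p : Submodule k (Fin 4 → k)) ≤ l0 k) : f p = 0 := by
  induction hf using span_induction with
  | mem g hg =>
    obtain ⟨l, hl, rfl⟩ := hg
    refine if_neg fun hpl => ?_
    have hbot : (p : Submodule k (Fin 4 → k)) = ⊥ := eq_bot_iff.mpr (hl.2 ▸ le_inf hpl hp)
    have hrank := p.2
    rw [IsPt, hbot, finrank_bot] at hrank
    exact zero_ne_one hrank
  | zero => rfl
  | add f g _ _ hf hg => simp [hf, hg]
  | smul r f _ hf => simp [hf]

/-- The lines through `p0` other than `ℓ0`. -/
def lineThroughP0 (s : k) : Submodule k (Fin 4 → k) := span k {e k 0, ![0, s, 1, 0]}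

lemma mem_lineThroughP0 (s : k) (v : Fin 4 → k) :
    v ∈ lineThroughP0 k s ↔ v 1 = v 2 * s ∧ v 3 = 0 := by
  rw [lineThroughP0, mem_span_pair]
  constructor
  · rintro ⟨a, b, rfl⟩
    simp [e]
  · rintro ⟨h1, h3⟩
    refine ⟨v 0, v 2, ?_⟩
    ext i
    fin_cases i <;> simp [e, h1, h3]

lemma chi_lineThroughP0_mem_X0 (s : k) : chi k (lineThroughP0 k s) ∈ X0 k := by
  refine ⟨⟨_, ⟨⟨?_, fun u hu v hv => ?_⟩, ?_⟩, rfl⟩, fun h => ?_⟩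
  · have hind : LinearIndependent k ![e k 0, ![0, s, 1, 0]] := by
      refine LinearIndependent.pair_iff.mpr fun a b hab => ⟨?_, ?_⟩
      · simpa [e] using congrFun hab 0
      · simpa [e] using congrFun hab 2
    have := finrank_span_eq_card hind
    rwa [Matrix.range_cons_cons_empty, Fintype.card_fin] at this
  · rw [mem_lineThroughP0] at hu hv
    rw [B, hu.1, hu.2, hv.1, hv.2]
    ring
  · exact span_mono (by simp)
  · have := congrFun (Set.mem_singleton_iff.mp h) (inftyPt k 0 s)
    simp [inftyPt, chi_ptOf, mem_lineThroughP0, mem_l0] at this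

/-- Codewords of `C(P,L1)` vanishing on `P1` are sums of lines through `p0`. -/
lemma mem_span_X0_of_piP1_eq_zero {m : ℕ} (hm : Fintype.card k = 2 ^ (m + 1))
    {f : Pt k → ZMod 2} (hf : f ∈ CPL1 k) (hπ : piP1 k f = 0) : f ∈ span (ZMod 2) (X0 k) := by
  have : CharP k 2 := by
    have := Fact.mk Nat.prime_two
    exact charP_of_card_eq_prime_pow hm
  have hP1 {p : Pt k} (hp : InP1 k p) : f p = 0 := congrFun hπ ⟨p, hp⟩
  have haff (a b c : k) : f (affinePt k a b c) = 0 := hP1 (inP1_ptOf k _ (by simp))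
  have hcast : Function.Injective (ZMod.castHom (dvd_refl 2) k) := RingHom.injective _
  have hsq (r : ZMod 2) : r ^ 2 = r := by revert r; decide
  obtain ⟨hconst, hsum⟩ := const_of_orthogonal hm
    (fun x s => ZMod.castHom (dvd_refl 2) k (f (inftyPt k x s)))
    (fun x s => by rw [← map_pow, hsq]) fun H G hHG => by
      rw [← sum_affinePt_eq_sum_inftyPt k hf hHG]
      simp [haff]
  rw [← map_sum, map_eq_zero_iff _ hcast] at hsum
  have hdecomp : f = ∑ s, f (inftyPt k 0 s) • chi k (lineThroughP0 k s) := by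
    ext p
    obtain ⟨v, hv, rfl⟩ := exists_eq_ptOf k p
    simp only [Finset.sum_apply, Pi.smul_apply, chi_ptOf, mem_lineThroughP0, smul_eq_mul]
    by_cases h3 : v 3 = 0
    · by_cases h2 : v 2 = 0
      · have hl0 : f (ptOf k v hv) = 0 := apply_eq_zero_of_le_l0 k hf
          ((span_singleton_le_iff_mem v _).mpr ((mem_l0 k v).mpr ⟨h2, h3⟩))
        by_cases h1 : v 1 = 0 <;> simp [h1, h2, h3, hl0, hsum]
      · have hpt : ptOf k v hv = inftyPt k (v 0 / v 2) (v 1 / v 2) := by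
          refine ptOf_eq_of_smul k hv _ (c := v 2) ?_
          ext i
          fin_cases i <;> simp [h3] <;> field_simp
        have hiff (s : k) : v 1 = v 2 * s ↔ s = v 1 / v 2 := by
          rw [eq_div_iff h2, mul_comm s, eq_comm]
        rw [hpt, hcast (hconst (v 0 / v 2) 0 (v 1 / v 2))]
        simp [h3, hiff]
    · simp [h3, hP1 (inP1_ptOf k hv h3)]
  rw [hdecomp]
  exact sum_mem fun s _ => smul_mem _ _ (subset_span (chi_lineThroughP0_mem_X0 k s))

theorem span_Z_X0_eq_span_L1_X0 (t : ℕ) (ht : 0 < t) (q : ℕ) (hq : q = 2 ^ t)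
    (hcard : Fintype.card k = q)
    -- `Z`: characteristic functions of lines of `L1` mapped bijectively by `π` to a
    -- basis of `C(P1,L1)`
    (Z : Set (Pt k → ZMod 2)) (hZsub : Z ⊆ chi k '' L1 k)
    (hZinj : Set.InjOn (piP1 k) Z)
    (hZind : LinearIndependent (ZMod 2)
      (fun z : (piP1 k '' Z : Set ({p : Pt k // InP1 k p} → ZMod 2)) =>
        (z : {p : Pt k // InP1 k p} → ZMod 2)))
    (hZspan : span (ZMod 2) (piP1 k '' Z) = CP1L1 k) :
    span (ZMod 2) (Z ∪ X0 k) = span (ZMod 2) (chi k '' L1 k ∪ X0 k) := by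
  obtain ⟨m, rfl⟩ : ∃ m, t = m + 1 := ⟨t - 1, by omega⟩
  have hm : Fintype.card k = 2 ^ (m + 1) := hcard.trans hq
  refine le_antisymm (span_mono (Set.union_subset_union_left _ hZsub)) (span_le.mpr ?_)
  rintro _ (⟨l, hl, rfl⟩ | hx)
  · have hlC : chi k l ∈ CPL1 k := subset_span ⟨l, hl, rfl⟩
    obtain ⟨z, hz, hzl⟩ : piP1 k (chi k l) ∈ (span (ZMod 2) Z).map (piP1 k) := by
      rw [map_span, hZspan]
      exact mem_map_of_mem hlC
    have hdiff := mem_span_X0_of_piP1_eq_zero k hm (sub_mem hlC (span_mono hZsub hz))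
      (by rw [map_sub, hzl, sub_self])
    rw [SetLike.mem_coe, span_union, ← add_sub_cancel z (chi k l)]
    exact add_mem_sup hz hdiff
  · exact subset_span (Or.inr hx)
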